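/- For every integer k ≥ 1, Σ_{s ∈ {A,B}^k} γ⁺(U_s) = 2^{3^k − k − 1}. -/

import Mathlib

open Finset

open scoped Classical

noncomputable section

/-- `A = {1,3,5}` and `B = {0,2,4}` as subsets of `Fin 6`; a type `s : Fin k → Bool`
assigns to each coordinate one of the two sets (`true ↦ B`, `false ↦ A`). -/
def typeSet (b : Bool) : Finset (Fin 6) := if b then {0, 2, 4} else {1, 3, 5}

/-- The largest maximal unlinked set `U_s = {u : u i ∈ s i for all i}`. -/
def Us (k : ℕ) (s : Fin k → Bool) : Finset (Fin k → Fin 6) :=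
  Finset.univ.filter fun u => ∀ i, u i ∈ typeSet (s i)

/-- `λ_k(u) ∈ 𝔽₂`: the parity of `#{i : u i ∈ {2,4}}`. -/
def lamK {k : ℕ} (u : Fin k → Fin 6) : ZMod 2 :=
  ((Finset.univ.filter fun i => u i = 2 ∨ u i = 4).card : ZMod 2)

/-- `c(u,v) ∈ 𝔽₂`: the parity of `#{i : u i, v i ∈ {0,2,4} and u i ≠ v i}`. -/
def cPair {k : ℕ} (u v : Fin k → Fin 6) : ZMod 2 :=
  ((Finset.univ.filter fun i =>
      (u i = 0 ∨ u i = 2 ∨ u i = 4) ∧ (v i = 0 ∨ v i = 2 ∨ v i = 4) ∧ u i ≠ v i).card :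
    ZMod 2)

lemma cPair_symm {k : ℕ} (u v : Fin k → Fin 6) : cPair u v = cPair v u := by
  unfold cPair
  congr 1
  congr 1
  apply Finset.filter_congr
  intro i _
  constructor
  · rintro ⟨h1, h2, h3⟩; exact ⟨h2, h1, h3.symm⟩
  · rintro ⟨h1, h2, h3⟩; exact ⟨h2, h1, h3.symm⟩

/-- The sum `Σ_{{u,v} ⊆ U_s, u ≠ v} c(u,v)·x(u)·x(v) ∈ 𝔽₂` over unordered pairs of
distinct elements of `U_s`. -/
def pairSum (k : ℕ) (s : Fin k → Bool) (x : {u // u ∈ Us k s} → ZMod 2) : ZMod 2 :=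
  ∑ p ∈ (Us k s).attach.sym2.filter fun p => ¬p.IsDiag,
    Sym2.lift
      ⟨fun u v => cPair u.1 v.1 * x u * x v, by
        intro u v
        show cPair u.1 v.1 * x u * x v = cPair v.1 u.1 * x v * x u
        rw [cPair_symm]
        ring⟩
      p

/-- `e(x) = Σ_{u ∈ U_s} λ_k(u)·x(u) + Σ_{{u,v} ⊆ U_s, u ≠ v} c(u,v)·x(u)·x(v) ∈ 𝔽₂`. -/
def eFun (k : ℕ) (s : Fin k → Bool) (x : {u // u ∈ Us k s} → ZMod 2) : ZMod 2 :=
  (∑ u ∈ (Us k s).attach, lamK u.1 * x u) + pairSum k s x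

/-- `x : U_s → 𝔽₂` is admissible if for every `i` the sum of `x` over
`{u ∈ U_s : u i ∈ {0,3}}` is `1` and the sums over `{u : u i ∈ {2,5}}` and
`{u : u i ∈ {1,4}}` are `0`. -/
def Admissible (k : ℕ) (s : Fin k → Bool) (x : {u // u ∈ Us k s} → ZMod 2) : Prop :=
  ∀ i : Fin k,
    (∑ u ∈ (Us k s).attach.filter fun u => u.1 i = 0 ∨ u.1 i = 3, x u) = 1 ∧
      (∑ u ∈ (Us k s).attach.filter fun u => u.1 i = 2 ∨ u.1 i = 5, x u) = 0 ∧
      (∑ u ∈ (Us k s).attach.filter fun u => u.1 i = 1 ∨ u.1 i = 4, x u) = 0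

/-- `γ(U_s) = Σ_{x admissible} σ(x)` where `σ(x) = 1` if `e(x) = 0` and `-1` otherwise. -/
def gammaU (k : ℕ) (s : Fin k → Bool) : ℤ :=
  ∑ x ∈ Finset.univ.filter fun x : {u // u ∈ Us k s} → ZMod 2 => Admissible k s x,
    if eFun k s x = 0 then (1 : ℤ) else -1

/-- `x : U_s → 𝔽₂` is homogeneously admissible if for every `i` the sums of `x` over
`{u ∈ U_s : u i ∈ {0,3}}`, `{u : u i ∈ {2,5}}` and `{u : u i ∈ {1,4}}` all vanish. -/
def HomAdmissible (k : ℕ) (s : Fin k → Bool) (x : {u // u ∈ Us k s} → ZMod 2) : Prop :=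
  ∀ i : Fin k,
    (∑ u ∈ (Us k s).attach.filter fun u => u.1 i = 0 ∨ u.1 i = 3, x u) = 0 ∧
      (∑ u ∈ (Us k s).attach.filter fun u => u.1 i = 2 ∨ u.1 i = 5, x u) = 0 ∧
      (∑ u ∈ (Us k s).attach.filter fun u => u.1 i = 1 ∨ u.1 i = 4, x u) = 0

/-- `γ⁺(U_s) = Σ_{x homogeneously admissible} σ(x)`, where `σ(x) = 1` if
`e⁺(x) = Σ_{{u,v}} c(u,v)x(u)x(v) = 0` and `σ(x) = -1` otherwise. -/
def gammaPlus (k : ℕ) (s : Fin k → Bool) : ℤ :=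
  ∑ x ∈ Finset.univ.filter fun x : {u // u ∈ Us k s} → ZMod 2 => HomAdmissible k s x,
    if pairSum k s x = 0 then (1 : ℤ) else -1

/-- An off-diagonal sum over unordered pairs of a symmetrised function is a sum over all ordered
pairs. -/
lemma sum_sym2_filter_not_isDiag_of_eq_add {ι M : Type*} [AddCommMonoid M]
    [DecidablePred fun q : Sym2 ι => ¬ q.IsDiag] (S : Finset ι)
    (p : Sym2 ι → M) (g : ι → ι → M) (hp : ∀ u v, p s(u, v) = g u v + g v u)
    (hg : ∀ u, g u u = 0) :
    ∑ q ∈ S.sym2.filter (fun q => ¬ q.IsDiag), p q = ∑ u ∈ S, ∑ v ∈ S, g u v := by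
  let _ : LinearOrder ι := linearOrderOfSTO WellOrderingRel
  have swap : ∑ q ∈ S.offDiag with q.1 < q.2, g q.2 q.1 =
      ∑ q ∈ S.offDiag with ¬ q.1 < q.2, g q.1 q.2 := by
    refine Finset.sum_nbij' Prod.swap Prod.swap ?_ ?_ ?_ ?_ ?_
    · rintro ⟨a, b⟩ hab
      simp only [mem_filter, mem_offDiag, Prod.swap] at hab ⊢
      exact ⟨⟨hab.1.2.1, hab.1.1, hab.1.2.2.symm⟩, hab.2.not_gt⟩
    · rintro ⟨a, b⟩ hab
      simp only [mem_filter, mem_offDiag, Prod.swap] at hab ⊢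
      exact ⟨⟨hab.1.2.1, hab.1.1, hab.1.2.2.symm⟩,
        lt_of_le_of_ne (not_lt.mp hab.2) hab.1.2.2.symm⟩
    all_goals simp
  have hoff : ∑ q ∈ S.offDiag, g q.1 q.2 = ∑ q ∈ S ×ˢ S, g q.1 q.2 := by
    refine Finset.sum_subset (fun q hq => ?_) (fun q hq hq' => ?_)
    · simp only [mem_offDiag, mem_product] at hq ⊢
      exact ⟨hq.1, hq.2.1⟩
    · obtain ⟨a, b⟩ := q
      simp only [mem_offDiag, mem_product] at hq hq'
      obtain rfl : a = b := by
        by_contra hab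
        exact hq' ⟨hq.1, hq.2, hab⟩
      exact hg a
  trans ∑ q ∈ S.offDiag with q.1 < q.2, p s(q.1, q.2)
  · convert Finset.sum_sym2_filter_not_isDiag S p
  rw [← Finset.sum_product' S S g, ← hoff]
  simp only [hp, Finset.sum_add_distrib]
  rw [swap, Finset.sum_filter_add_sum_filter_not]

/-- The homogeneous conditions say that all coordinate slices of `x` have zero sum. -/
lemma HomAdmissible.sum_slice {k : ℕ} {s : Fin k → Bool} {x : {u // u ∈ Us k s} → ZMod 2}
    (hx : HomAdmissible k s x) (i : Fin k) (a : Fin 6) :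
    ∑ u, (if u.1 i = a then x u else 0) = 0 := by
  have mem : ∀ u : {u // u ∈ Us k s}, u.1 i ∈ typeSet (s i) := fun u =>
    (Finset.mem_filter.mp u.2).2 i
  obtain ⟨h0, h1, h2⟩ := hx i
  rw [Finset.sum_filter] at h0 h1 h2
  have key : ∀ b c : Fin 6, (b ∈ typeSet (s i) → c ∉ typeSet (s i)) →
      ∑ u ∈ (Us k s).attach, (if u.1 i = b ∨ u.1 i = c then x u else 0) = 0 →
      ∀ a, (a = b ∨ a = c) → ∑ u, (if u.1 i = a then x u else 0) = 0 := by
    intro b c hbc h a ha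
    by_cases has : a ∈ typeSet (s i)
    · rw [← h]
      refine Finset.sum_congr rfl fun u _ => ?_
      have hu := mem u
      congr 1
      apply propext
      constructor
      · rintro rfl
        exact ha
      · grind
    · refine Finset.sum_eq_zero fun u _ => if_neg ?_
      rintro rfl
      exact has (mem u)
  have disj : ∀ t : Bool, (0 ∈ typeSet t → 3 ∉ typeSet t) ∧ (2 ∈ typeSet t → 5 ∉ typeSet t) ∧
      (1 ∈ typeSet t → 4 ∉ typeSet t) := by
    unfold typeSet
    intro t
    cases t <;> simp
  obtain ⟨d0, d1, d2⟩ := disj (s i)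
  have ha : (a = 0 ∨ a = 3) ∨ (a = 2 ∨ a = 5) ∨ (a = 1 ∨ a = 4) := by
    revert a
    decide
  rcases ha with ha | ha | ha
  · exact key _ _ d0 h0 a ha
  · exact key _ _ d1 h1 a ha
  · exact key _ _ d2 h2 a ha

lemma cPair_eq_sum {k : ℕ} {s : Fin k → Bool} {u v : Fin k → Fin 6} (hu : u ∈ Us k s)
    (hv : v ∈ Us k s) :
    cPair u v = ∑ i, ((if s i ∧ u i < v i then 1 else 0) + if s i ∧ v i < u i then 1 else 0) := by
  unfold cPair
  rw [Finset.card_filter]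
  push_cast
  refine Finset.sum_congr rfl fun i _ => ?_
  have hui := (Finset.mem_filter.mp hu).2 i
  have hvi := (Finset.mem_filter.mp hv).2 i
  unfold typeSet at hui hvi
  cases hs : s i
  · simp only [hs, Bool.false_eq_true, if_false, mem_insert, mem_singleton] at hui
    rw [if_neg]
    · simp
    · rintro ⟨h, -⟩
      rcases hui with h' | h' | h' <;> simp [h'] at h
  · simp only [hs, if_true, mem_insert, mem_singleton] at hui hvi
    rcases lt_trichotomy (u i) (v i) with h | h | h
    · rw [if_pos ⟨hui, hvi, h.ne⟩]
      simp [h, h.not_gt]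
    · simp [h]
    · rw [if_pos ⟨hui, hvi, h.ne'⟩]
      simp [h, h.not_gt]

/-- The quadratic form vanishes on homogeneously admissible functions. -/
lemma HomAdmissible.pairSum_eq_zero {k : ℕ} {s : Fin k → Bool} {x : {u // u ∈ Us k s} → ZMod 2}
    (hx : HomAdmissible k s x) : pairSum k s x = 0 := by
  unfold pairSum
  rw [sum_sym2_filter_not_isDiag_of_eq_add _ _
    (fun u v => ∑ i, if s i ∧ u.1 i < v.1 i then x u * x v else 0)]
  · rw [Finset.sum_comm]
    refine Finset.sum_eq_zero fun v _ => ?_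
    rw [Finset.sum_comm]
    refine Finset.sum_eq_zero fun i _ => ?_
    have below : ∑ u ∈ (Us k s).attach, (if u.1 i < v.1 i then x u else 0) = 0 := by
      have split : ∀ u : {u // u ∈ Us k s}, (if u.1 i < v.1 i then x u else 0) =
          ∑ a ∈ Finset.univ.filter (· < v.1 i), if u.1 i = a then x u else 0 := by
        intro u
        rw [Finset.sum_ite_eq]
        simp
      simp only [split]
      rw [Finset.sum_comm]
      exact Finset.sum_eq_zero fun a _ => hx.sum_slice i a
    by_cases hs : s i
    · simp only [hs, true_and]
      simp only [← ite_zero_mul]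
      rw [← Finset.sum_mul, below, zero_mul]
    · simp [hs]
  · intro u v
    simp only [Sym2.lift_mk]
    rw [cPair_eq_sum u.2 v.2, Finset.sum_mul, Finset.sum_mul, ← Finset.sum_add_distrib]
    refine Finset.sum_congr rfl fun i _ => ?_
    rw [add_mul, add_mul]
    congr 1
    · split_ifs <;> simp
    · split_ifs <;> simp [mul_comm]
  · intro u
    simp

/-- The element of `typeSet b` in the class `{0,3}` (`none`), `{2,5}` (`some false`) or
`{1,4}` (`some true`). -/
def classRep (b : Bool) : Option Bool → Fin 6
  | none => if b then 0 else 3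
  | some false => if b then 2 else 5
  | some true => if b then 4 else 1

lemma mem_typeSet_iff (b : Bool) (a : Fin 6) : a ∈ typeSet b ↔ ∃ c, classRep b c = a := by
  revert b a
  unfold typeSet
  simp only [Option.exists, Bool.exists_bool, classRep]
  intro b a
  cases b <;> fin_cases a <;> simp

lemma classRep_injective (b : Bool) : Function.Injective (classRep b) := by
  revert b
  decide

/-- The point of `Us k s` whose coordinates lie in the classes prescribed by `c`. -/
def pointOfClass {k : ℕ} (s : Fin k → Bool) (c : Fin k → Option Bool) : {u // u ∈ Us k s} :=
  ⟨fun i => classRep (s i) (c i), Finset.mem_filter.mpr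
    ⟨Finset.mem_univ _, fun i => (mem_typeSet_iff _ _).mpr ⟨c i, rfl⟩⟩⟩

/-- Points of `Us k s` correspond to choices of a class in every coordinate. -/
def pointEquiv {k : ℕ} (s : Fin k → Bool) : (Fin k → Option Bool) ≃ {u // u ∈ Us k s} :=
  Equiv.ofBijective (pointOfClass s) <| by
    constructor
    · intro c d h
      funext i
      exact classRep_injective (s i) (congrFun (congrArg Subtype.val h) i)
    · rintro ⟨u, hu⟩
      have h := fun i => (mem_typeSet_iff _ _).mp ((Finset.mem_filter.mp hu).2 i)
      choose c hc using h
      exact ⟨c, Subtype.ext (funext hc)⟩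

/-- The total sum of a function, and its sums over the slices `c i = some b`. -/
def sliceSums (k : ℕ) : ((Fin k → Option Bool) → ZMod 2) →ₗ[ZMod 2]
    (Option (Fin k × Bool) → ZMod 2) where
  toFun x o := o.elim (∑ c, x c) fun j => ∑ c, if c j.1 = some j.2 then x c else 0
  map_add' x y := by
    funext o
    cases o <;> simp [← Finset.sum_add_distrib, ite_add_zero]
  map_smul' r x := by
    funext o
    cases o <;> simp [Finset.mul_sum]

lemma sliceSums_surjective (k : ℕ) : Function.Surjective (sliceSums k) := by
  have base : sliceSums k (Pi.single (fun _ => none) 1) = Pi.single none 1 := by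
    funext o
    rcases o with _ | ⟨i, b⟩
    · simp [sliceSums]
    · simp only [sliceSums, LinearMap.coe_mk, AddHom.coe_mk, Option.elim]
      rw [Pi.single_eq_of_ne (by simp)]
      refine Finset.sum_eq_zero fun c _ => ?_
      split_ifs with h
      · refine Pi.single_eq_of_ne ?_ _
        rintro rfl
        simp at h
      · rfl
  have step : ∀ j : Fin k × Bool,
      sliceSums k (Pi.single (Function.update (fun _ => none) j.1 (some j.2)) 1) =
        Pi.single none 1 + Pi.single (some j) 1 := by
    intro j
    funext o
    rcases o with _ | i
    · simp [sliceSums]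
    · simp only [sliceSums, LinearMap.coe_mk, AddHom.coe_mk, Option.elim, Pi.add_apply]
      rw [Pi.single_eq_of_ne (by simp), zero_add,
        Finset.sum_eq_single (Function.update (fun _ => none) j.1 (some j.2))]
      · rw [Pi.single_eq_same, Pi.single_apply]
        congr 1
        obtain ⟨i, a⟩ := i
        obtain ⟨j, b⟩ := j
        by_cases h : i = j
        · subst h
          simp [eq_comm]
        · simp [h]
      · intro c _ hc
        simp [Pi.single_eq_of_ne hc]
      · simp
  have mem : ∀ o, Pi.single o 1 ∈ LinearMap.range (sliceSums k) := by
    have h0 : Pi.single none 1 ∈ LinearMap.range (sliceSums k) := ⟨_, base⟩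
    rintro (_ | j)
    · exact h0
    · have hj := Submodule.sub_mem _ (⟨_, step j⟩ : _ ∈ LinearMap.range (sliceSums k)) h0
      rwa [add_sub_cancel_left] at hj
  rw [← LinearMap.range_eq_top, eq_top_iff]
  intro y _
  rw [pi_eq_sum_univ' y]
  refine Submodule.sum_mem _ fun o _ => Submodule.smul_mem _ _ ?_
  convert mem o

lemma card_ker_sliceSums (k : ℕ) :
    Nat.card (LinearMap.ker (sliceSums k)) = 2 ^ (3 ^ k - (2 * k + 1)) := by
  have h := LinearMap.finrank_range_add_finrank_ker (sliceSums k)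
  rw [LinearMap.range_eq_top.mpr (sliceSums_surjective k), finrank_top,
    Module.finrank_fintype_fun_eq_card, Module.finrank_fintype_fun_eq_card] at h
  simp only [Fintype.card_option, Fintype.card_prod, Fintype.card_fin, Fintype.card_bool,
    Fintype.card_fun] at h
  rw [Module.natCard_eq_pow_finrank (K := ZMod 2), Nat.card_zmod]
  congr 1
  norm_num at h
  omega

lemma homAdmissible_iff {k : ℕ} (hk : 1 ≤ k) (s : Fin k → Bool)
    (x : {u // u ∈ Us k s} → ZMod 2) :
    HomAdmissible k s x ↔ x ∘ pointEquiv s ∈ LinearMap.ker (sliceSums k) := by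
  have slice : ∀ (i : Fin k) (o : Option Bool) (p : Fin 6 → Prop) [DecidablePred p],
      (∀ t o', p (classRep t o') ↔ o' = o) →
      ∑ u ∈ (Us k s).attach.filter (fun u => p (u.1 i)), x u =
        ∑ c, if c i = o then x (pointEquiv s c) else 0 := by
    intro i o p _ hp
    rw [Finset.sum_filter]
    refine ((pointEquiv s).sum_comp (fun u => if p (u.1 i) then x u else 0)).symm.trans ?_
    refine Finset.sum_congr rfl fun c _ => ?_
    have hpc : p ((pointEquiv s c).1 i) ↔ c i = o := hp (s i) (c i)
    simp only [hpc]
  have total : ∀ i : Fin k, ∑ c, x (pointEquiv s c) =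
      (∑ c, if c i = none then x (pointEquiv s c) else 0) +
      ((∑ c, if c i = some false then x (pointEquiv s c) else 0) +
      ∑ c, if c i = some true then x (pointEquiv s c) else 0) := by
    intro i
    rw [← Finset.sum_add_distrib, ← Finset.sum_add_distrib]
    refine Finset.sum_congr rfl fun c _ => ?_
    rcases c i with _ | _ | _ <;> simp
  have hnone : ∀ t o', (classRep t o' = 0 ∨ classRep t o' = 3) ↔ o' = none := by decide
  have hfalse : ∀ t o', (classRep t o' = 2 ∨ classRep t o' = 5) ↔ o' = some false := by decide
  have htrue : ∀ t o', (classRep t o' = 1 ∨ classRep t o' = 4) ↔ o' = some true := by decide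
  unfold HomAdmissible
  have reindex := fun i => and_congr
    (Eq.congr_left (z := 0) (slice i none (fun a => a = 0 ∨ a = 3) hnone))
    (and_congr (Eq.congr_left (z := 0) (slice i (some false) (fun a => a = 2 ∨ a = 5) hfalse))
    (Eq.congr_left (z := 0) (slice i (some true) (fun a => a = 1 ∨ a = 4) htrue)))
  refine (forall_congr' reindex).trans ?_
  rw [LinearMap.mem_ker, funext_iff, Option.forall]
  simp only [sliceSums, LinearMap.coe_mk, AddHom.coe_mk, Option.elim, Function.comp_apply,
    Prod.forall, Bool.forall_bool, Pi.zero_apply]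
  constructor
  · intro h
    refine ⟨?_, fun i => (h i).2⟩
    obtain ⟨h0, h1, h2⟩ := h ⟨0, hk⟩
    rw [total ⟨0, hk⟩, h0, h1, h2]
    simp
  · rintro ⟨h, h'⟩ i
    refine ⟨?_, h' i⟩
    rw [total i, (h' i).1, (h' i).2] at h
    simpa using h

lemma card_homAdmissible {k : ℕ} (hk : 1 ≤ k) (s : Fin k → Bool) :
    (Finset.univ.filter fun x : {u // u ∈ Us k s} → ZMod 2 => HomAdmissible k s x).card =
      2 ^ (3 ^ k - (2 * k + 1)) := by
  rw [← card_ker_sliceSums, ← Fintype.card_subtype, ← Nat.card_eq_fintype_card]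
  exact Nat.card_congr (((pointEquiv s).symm.arrowCongr (Equiv.refl (ZMod 2))).subtypeEquiv
    fun x => homAdmissible_iff hk s x)

lemma gammaPlus_eq {k : ℕ} (hk : 1 ≤ k) (s : Fin k → Bool) :
    gammaPlus k s = 2 ^ (3 ^ k - (2 * k + 1)) := by
  unfold gammaPlus
  rw [Finset.sum_congr rfl fun x hx =>
    if_pos (HomAdmissible.pairSum_eq_zero (Finset.mem_filter.mp hx).2)]
  rw [Finset.sum_const, card_homAdmissible hk]
  simp

lemma two_mul_add_one_le_three_pow (k : ℕ) : 2 * k + 1 ≤ 3 ^ k := by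
  induction k with
  | zero => simp
  | succ k ih =>
    rw [pow_succ]
    omega

theorem sum_gammaPlus_eq (k : ℕ) (hk : 1 ≤ k) :
    ∑ s : Fin k → Bool, gammaPlus k s = 2 ^ (3 ^ k - k - 1) := by
  simp only [gammaPlus_eq hk, Finset.sum_const, Finset.card_univ, Fintype.card_fun,
    Fintype.card_bool, Fintype.card_fin, nsmul_eq_mul]
  push_cast
  rw [← pow_add]
  congr 1
  have := two_mul_add_one_le_three_pow k
  omega
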